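/- Let B be the open unit ball of ℂ². There is no function g : B × B → ℂ such that (a) for each fixed λ ∈ B the function μ ↦ g(μ,λ) is holomorphic on B, (b) g(λ,μ) = conj(g(μ,λ)) for all λ, μ ∈ B, and (c) for every positive integer n, all distinct λ₁, …, λₙ ∈ B and all z₁, …, zₙ ∈ ℂ, the n×n matrix whose (i,j) entry is (1 − zᵢ·conj(zⱼ))·g(λᵢ,λⱼ) is positive semidefinite if and only if there exists a holomorphic function φ : B → ℂ with sup_{w∈B} |φ(w)| ≤ 1 and φ(λᵢ) = zᵢ for each i. In other words, there is no (Hermitian, holomorphic-in-the-first-variable) kernel on the ball of ℂ² with respect to which the Nevanlinna–Pick theorem holds in the H^∞ norm. -/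

import Mathlib

open Complex Metric
open scoped ComplexOrder

/-- A `2 × 2` positivity criterion. -/
lemma psd_two (A : Matrix (Fin 2) (Fin 2) ℂ) (a c : ℝ) (b : ℂ) (h00 : A 0 0 = a)
    (h11 : A 1 1 = c) (h01 : A 0 1 = b) (h10 : A 1 0 = (starRingEnd ℂ) b) (ha : 0 < a)
    (hb : ‖b‖ ^ 2 ≤ a * c) : A.PosSemidef := by
  refine Matrix.PosSemidef.of_dotProduct_mulVec_nonneg ?_ ?_
  · ext i j
    fin_cases i <;> fin_cases j <;> simp [Matrix.conjTranspose_apply, h00, h11, h01, h10]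
  · intro x
    have hE : star x ⬝ᵥ (A.mulVec x) =
        (((‖a * x 0 + b * x 1‖ ^ 2 + (a * c - ‖b‖ ^ 2) * ‖x 1‖ ^ 2) / a : ℝ) : ℂ) := by
      have ha' : (a : ℂ) ≠ 0 := by exact_mod_cast ha.ne'
      push_cast
      rw [← Complex.mul_conj', ← Complex.mul_conj', ← Complex.mul_conj']
      simp only [Matrix.mulVec, dotProduct, Fin.sum_univ_two, h00, h11, h01, h10, Pi.star_apply,
        map_add, map_mul, Complex.conj_ofReal, RCLike.star_def]
      field_simp
      ring
    rw [hE]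
    have : 0 ≤ (‖a * x 0 + b * x 1‖ ^ 2 + (a * c - ‖b‖ ^ 2) * ‖x 1‖ ^ 2) / a := by
      have := sub_nonneg.2 hb
      positivity
    exact_mod_cast this

lemma psd_two_det (A : Matrix (Fin 2) (Fin 2) ℂ) (a c : ℝ) (b : ℂ) (h00 : A 0 0 = a)
    (h11 : A 1 1 = c) (h01 : A 0 1 = b) (h10 : A 1 0 = (starRingEnd ℂ) b)
    (hA : A.PosSemidef) : ‖b‖ ^ 2 ≤ a * c := by
  have h := hA.det_nonneg
  rw [Matrix.det_fin_two, h00, h11, h01, h10, Complex.mul_conj'] at h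
  have h2 : (0 : ℂ) ≤ ((a * c - ‖b‖ ^ 2 : ℝ) : ℂ) := by push_cast; exact h
  have h3 : 0 ≤ a * c - ‖b‖ ^ 2 := by exact_mod_cast h2
  linarith

/-- The inner product on `ℂ²`, linear in the first variable. -/
noncomputable def ip (w a : EuclideanSpace ℂ (Fin 2)) : ℂ :=
  w 0 * (starRingEnd ℂ) (a 0) + w 1 * (starRingEnd ℂ) (a 1)

lemma nsq (w : EuclideanSpace ℂ (Fin 2)) : ‖w‖ ^ 2 = ‖w 0‖ ^ 2 + ‖w 1‖ ^ 2 := by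
  simp [EuclideanSpace.norm_sq_eq, Fin.sum_univ_two]

lemma ip_self (w : EuclideanSpace ℂ (Fin 2)) : ip w w = ((‖w‖ ^ 2 : ℝ) : ℂ) := by
  rw [nsq, ip, Complex.mul_conj', Complex.mul_conj']; push_cast; rfl

lemma lagrange (w a : EuclideanSpace ℂ (Fin 2)) :
    ‖ip w a‖ ^ 2 + ‖w 0 * a 1 - w 1 * a 0‖ ^ 2 = ‖w‖ ^ 2 * ‖a‖ ^ 2 := by
  rw [nsq, nsq]
  have : ((‖ip w a‖ ^ 2 + ‖w 0 * a 1 - w 1 * a 0‖ ^ 2 : ℝ) : ℂ) =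
    (((‖w 0‖ ^ 2 + ‖w 1‖ ^ 2) * (‖a 0‖ ^ 2 + ‖a 1‖ ^ 2) : ℝ) : ℂ) := by
    push_cast
    simp only [← Complex.mul_conj', ip, map_add, map_sub, map_mul, Complex.conj_conj]
    ring
  exact_mod_cast this

lemma one_sub_ip_ne {w a : EuclideanSpace ℂ (Fin 2)} (hw : ‖w‖ < 1) (ha : ‖a‖ < 1) :
    1 - ip w a ≠ 0 := by
  intro h
  have h1 : ip w a = 1 := by linear_combination -h
  have h2 := lagrange w a
  rw [h1] at h2
  have h3 : ‖w‖ * ‖a‖ < 1 := by nlinarith [norm_nonneg w, norm_nonneg a]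
  have h4 : 0 ≤ ‖w‖ * ‖a‖ := by positivity
  simp only [norm_one] at h2
  nlinarith [sq_nonneg ‖w 0 * a 1 - w 1 * a 0‖]

lemma coord_diff (i : Fin 2) : Differentiable ℂ (fun w : EuclideanSpace ℂ (Fin 2) => w i) := by
  fun_prop

lemma ip_diff (a : EuclideanSpace ℂ (Fin 2)) : Differentiable ℂ (fun w => ip w a) := by
  unfold ip
  fun_prop

lemma diff_div {f h : EuclideanSpace ℂ (Fin 2) → ℂ} {s : Set (EuclideanSpace ℂ (Fin 2))}
    (hf : DifferentiableOn ℂ f s) (hh : DifferentiableOn ℂ h s) (h0 : ∀ w ∈ s, h w ≠ 0) :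
    DifferentiableOn ℂ (fun w => f w / h w) s := by
  simp only [div_eq_mul_inv]
  exact hf.mul (hh.inv h0)

lemma conj_two : (starRingEnd ℂ) 2 = 2 := map_ofNat _ 2

/-- Squared norm of the ball automorphism. -/
lemma auto_norm {w a : EuclideanSpace ℂ (Fin 2)} (hw : ‖w‖ < 1) (ha : ‖a‖ < 1) (ha0 : a ≠ 0) :
    (1 - (‖(‖a‖ - ip w a / ‖a‖) / (1 - ip w a)‖ ^ 2 +
      ‖√(1 - ‖a‖ ^ 2) * (w 0 * a 1 - w 1 * a 0) / ‖a‖ / (1 - ip w a)‖ ^ 2)) *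
        ‖1 - ip w a‖ ^ 2 = (1 - ‖a‖ ^ 2) * (1 - ‖w‖ ^ 2) := by
  have hN : 0 < ‖a‖ := norm_pos_iff.2 ha0
  have hne : 0 < ‖1 - ip w a‖ := norm_pos_iff.2 (one_sub_ip_ne hw ha)
  have hs : √(1 - ‖a‖ ^ 2) ^ 2 = 1 - ‖a‖ ^ 2 := Real.sq_sqrt (by nlinarith)
  have hl := lagrange w a
  have e1 : ‖1 - ip w a‖ ^ 2 = 1 - 2 * (ip w a).re + ‖ip w a‖ ^ 2 := by
    rw [← Complex.normSq_eq_norm_sq, ← Complex.normSq_eq_norm_sq]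
    simp [Complex.normSq_apply]; ring
  have e2 : ‖(‖a‖ : ℂ) - ip w a / ‖a‖‖ ^ 2 =
      ‖a‖ ^ 2 - 2 * (ip w a).re + ‖ip w a‖ ^ 2 / ‖a‖ ^ 2 := by
    rw [← Complex.normSq_eq_norm_sq, ← Complex.normSq_eq_norm_sq]
    simp [Complex.normSq_apply]; field_simp; ring
  rw [norm_div, div_pow, e2, norm_div, norm_div, norm_mul, div_pow, div_pow, mul_pow]
  have e3 : ‖((√(1 - ‖a‖ ^ 2) : ℝ) : ℂ)‖ ^ 2 = 1 - ‖a‖ ^ 2 := by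
    rw [Complex.norm_real, Real.norm_eq_abs, sq_abs, hs]
  have e4 : ‖(‖a‖ : ℂ)‖ = ‖a‖ := by simp
  rw [e3, e4]
  have e5 : ‖w 0 * a 1 - w 1 * a 0‖ ^ 2 = ‖w‖ ^ 2 * ‖a‖ ^ 2 - ‖ip w a‖ ^ 2 := by linarith
  rw [e5]
  have e6 : ∀ D X Y : ℝ, 0 < D → (1 - (X / D ^ 2 + Y / D ^ 2)) * D ^ 2 = D ^ 2 - X - Y := by
    intro D X Y hD
    field_simp
    ring
  rw [e6 _ _ _ hne, e1]
  field_simp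
  ring

/-- Existence of the extremal function. -/
lemma extremal {a b : EuclideanSpace ℂ (Fin 2)} (ha : ‖a‖ < 1) (hb : ‖b‖ < 1) (ha0 : a ≠ 0) :
    ∃ φ : EuclideanSpace ℂ (Fin 2) → ℂ,
      DifferentiableOn ℂ φ (ball (0 : EuclideanSpace ℂ (Fin 2)) 1) ∧
      (∀ w ∈ ball (0 : EuclideanSpace ℂ (Fin 2)) 1, ‖φ w‖ ≤ 1) ∧ φ a = 0 ∧
      (1 - ‖φ b‖ ^ 2) * ‖1 - ip b a‖ ^ 2 = (1 - ‖a‖ ^ 2) * (1 - ‖b‖ ^ 2) := by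
  have hN : 0 < ‖a‖ := norm_pos_iff.2 ha0
  obtain ⟨P, hP⟩ : ∃ P : EuclideanSpace ℂ (Fin 2) → ℂ,
    P = fun w => (‖a‖ - ip w a / ‖a‖) / (1 - ip w a) := ⟨_, rfl⟩
  obtain ⟨Q, hQ⟩ : ∃ Q : EuclideanSpace ℂ (Fin 2) → ℂ,
    Q = fun w => √(1 - ‖a‖ ^ 2) * (w 0 * a 1 - w 1 * a 0) / ‖a‖ / (1 - ip w a) := ⟨_, rfl⟩
  have hd := ip_diff a
  have hPd : DifferentiableOn ℂ P (ball 0 1) := by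
    rw [hP]
    refine diff_div (by fun_prop) (by fun_prop) ?_
    intro w hw
    exact one_sub_ip_ne (by simpa using hw) ha
  have hQd : DifferentiableOn ℂ Q (ball 0 1) := by
    rw [hQ]
    refine diff_div (by fun_prop) (by fun_prop) ?_
    intro w hw
    exact one_sub_ip_ne (by simpa using hw) ha
  have hPQ : ∀ w : EuclideanSpace ℂ (Fin 2), ‖w‖ < 1 →
      (1 - (‖P w‖ ^ 2 + ‖Q w‖ ^ 2)) * ‖1 - ip w a‖ ^ 2 = (1 - ‖a‖ ^ 2) * (1 - ‖w‖ ^ 2) := by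
    intro w hw
    rw [hP, hQ]
    exact auto_norm hw ha ha0
  have hle : ∀ w : EuclideanSpace ℂ (Fin 2), ‖w‖ < 1 → ‖P w‖ ^ 2 + ‖Q w‖ ^ 2 ≤ 1 := by
    intro w hw
    have h1 := hPQ w hw
    have h2 : 0 < ‖1 - ip w a‖ ^ 2 := by
      have := norm_pos_iff.2 (one_sub_ip_ne hw ha); positivity
    have h3 : 0 ≤ (1 - ‖a‖ ^ 2) * (1 - ‖w‖ ^ 2) :=
      mul_nonneg (by nlinarith) (by nlinarith [norm_nonneg w])
    rw [← h1] at h3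
    have := nonneg_of_mul_nonneg_left h3 h2
    linarith
  have hPa : P a = 0 := by
    rw [hP]; simp only [ip_self]
    have : (‖a‖ : ℂ) ≠ 0 := by exact_mod_cast hN.ne'
    push_cast
    field_simp
    simp
  have hQa : Q a = 0 := by
    rw [hQ]; simp only []
    rw [show a 0 * a 1 - a 1 * a 0 = 0 by ring]; simp
  obtain ⟨T, hT⟩ : ∃ T : ℝ, T = √(‖P b‖ ^ 2 + ‖Q b‖ ^ 2) := ⟨_, rfl⟩
  have hT2 : T ^ 2 = ‖P b‖ ^ 2 + ‖Q b‖ ^ 2 := by rw [hT]; exact Real.sq_sqrt (by positivity)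
  have hT0 : 0 ≤ T := by rw [hT]; positivity
  rcases hT0.eq_or_lt with h0 | h0
  · refine ⟨fun _ => 0, by fun_prop, by simp, rfl, ?_⟩
    rw [← hPQ b hb, ← hT2, ← h0]; simp
  · have hTc : (T : ℂ) ≠ 0 := by exact_mod_cast h0.ne'
    refine ⟨fun w => (P w * (starRingEnd ℂ) (P b) + Q w * (starRingEnd ℂ) (Q b)) / T,
      ?_, ?_, ?_, ?_⟩
    · exact diff_div (by fun_prop) (by fun_prop) (fun _ _ => hTc)
    · intro w hw
      have h1 := lagrange !₂[P w, Q w] !₂[P b, Q b]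
      rw [nsq, nsq] at h1
      simp only [ip] at h1
      simp at h1
      rw [← hT2] at h1
      have h2 := hle w (by simpa using hw)
      rw [norm_div, Complex.norm_real, Real.norm_of_nonneg hT0, div_le_one h0]
      refine abs_le_of_sq_le_sq' ?_ hT0 |>.2
      nlinarith [sq_nonneg ‖P w * Q b - Q w * P b‖, sq_nonneg T]
    · simp [hPa, hQa]
    · have : (P b * (starRingEnd ℂ) (P b) + Q b * (starRingEnd ℂ) (Q b)) / T = T := by
        rw [Complex.mul_conj', Complex.mul_conj', div_eq_iff hTc]
        have : ((T ^ 2 : ℝ) : ℂ) = ((‖P b‖ ^ 2 + ‖Q b‖ ^ 2 : ℝ) : ℂ) := by rw [hT2]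
        push_cast at this
        rw [← this]; ring
      simp only [this]
      rw [Complex.norm_real, Real.norm_of_nonneg hT0, hT2]
      exact hPQ b hb

/-- The four test points. -/
noncomputable def pt : Fin 4 → EuclideanSpace ℂ (Fin 2) :=
  ![!₂[1/2, 1/2], !₂[1/2, -1/2], !₂[-1/2, 1/2], !₂[-1/2, -1/2]]

lemma pt_inj : Function.Injective pt := by
  intro i j h
  have h0 := congrArg (fun w : EuclideanSpace ℂ (Fin 2) => (w 0).re) h
  have h1 := congrArg (fun w : EuclideanSpace ℂ (Fin 2) => (w 1).re) h
  fin_cases i <;> fin_cases j <;> first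
    | rfl
    | (exfalso; norm_num [pt] at h0; done)
    | (exfalso; norm_num [pt] at h1; done)

noncomputable def ep : Fin 4 → ℂ := ![1, -1, -1, 1]

/-- There is no Hermitian kernel `g` on the unit ball of `ℂ²`, holomorphic in its first
variable, with respect to which the Nevanlinna–Pick theorem holds in the `H^∞` norm. -/
theorem stmt7 :
    ¬ ∃ g : EuclideanSpace ℂ (Fin 2) → EuclideanSpace ℂ (Fin 2) → ℂ,
      (∀ lam ∈ ball (0 : EuclideanSpace ℂ (Fin 2)) 1,
        DifferentiableOn ℂ (fun mu => g mu lam) (ball (0 : EuclideanSpace ℂ (Fin 2)) 1)) ∧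
      (∀ lam ∈ ball (0 : EuclideanSpace ℂ (Fin 2)) 1,
        ∀ mu ∈ ball (0 : EuclideanSpace ℂ (Fin 2)) 1,
          g lam mu = (starRingEnd ℂ) (g mu lam)) ∧
      (∀ n : ℕ, 0 < n → ∀ lam : Fin n → EuclideanSpace ℂ (Fin 2),
        (∀ i, lam i ∈ ball (0 : EuclideanSpace ℂ (Fin 2)) 1) → Function.Injective lam →
        ∀ z : Fin n → ℂ,
        ((Matrix.of fun i j : Fin n =>
            (1 - z i * (starRingEnd ℂ) (z j)) * g (lam i) (lam j)).PosSemidef ↔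
          ∃ φ : EuclideanSpace ℂ (Fin 2) → ℂ,
            DifferentiableOn ℂ φ (ball (0 : EuclideanSpace ℂ (Fin 2)) 1) ∧
            (∀ w ∈ ball (0 : EuclideanSpace ℂ (Fin 2)) 1, ‖φ w‖ ≤ 1) ∧
            ∀ i, φ (lam i) = z i)) := by
  rintro ⟨g, hol, herm, pick⟩
  obtain ⟨G, hG⟩ : ∃ G : EuclideanSpace ℂ (Fin 2) → ℝ, G = fun w => (g w w).re := ⟨_, rfl⟩
  have hGg : ∀ w ∈ ball (0 : EuclideanSpace ℂ (Fin 2)) 1, g w w = G w := by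
    intro w hw
    rw [hG]
    exact ((Complex.conj_eq_iff_re).1 (herm w hw w hw).symm).symm
  have h0m : (0 : EuclideanSpace ℂ (Fin 2)) ∈ ball (0 : EuclideanSpace ℂ (Fin 2)) 1 := by simp
  -- one point
  have hGpos : ∀ w ∈ ball (0 : EuclideanSpace ℂ (Fin 2)) 1, 0 < G w := by
    intro w hw
    by_contra hneg
    have hneg : G w ≤ 0 := not_lt.1 hneg
    have := (pick 1 one_pos (fun _ => w) (fun _ => hw) (fun i j _ => Subsingleton.elim _ _)
      (fun _ => 2)).1 ?_
    · obtain ⟨φ, -, h1, h2⟩ := this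
      have := h1 w hw
      rw [h2 0] at this
      norm_num at this
    · refine Matrix.PosSemidef.of_dotProduct_mulVec_nonneg ?_ ?_
      · ext i j
        simp [Matrix.conjTranspose_apply, hGg w hw, conj_two]
      · intro x
        have : star x ⬝ᵥ ((Matrix.of fun i j : Fin 1 =>
            (1 - (2 : ℂ) * (starRingEnd ℂ) 2) * g w w).mulVec x) =
            ((3 * (-G w) * ‖x 0‖ ^ 2 : ℝ) : ℂ) := by
          simp [Matrix.mulVec, dotProduct, hGg w hw, conj_two]
          rw [← Complex.mul_conj']
          ring
        rw [this]
        have : 0 ≤ 3 * (-G w) * ‖x 0‖ ^ 2 := by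
          have : 0 ≤ -G w := by linarith
          positivity
        exact_mod_cast this
  -- two points, (A)
  have inj2 : ∀ a b : EuclideanSpace ℂ (Fin 2), a ≠ b → Function.Injective ![a, b] := by
    intro a b hab i j
    fin_cases i <;> fin_cases j <;> simp [hab, hab.symm]
  have hA : ∀ a ∈ ball (0 : EuclideanSpace ℂ (Fin 2)) 1, a ≠ 0 →
      ∀ b ∈ ball (0 : EuclideanSpace ℂ (Fin 2)) 1,
      ‖g b a‖ ^ 2 * ‖1 - ip b a‖ ^ 2 ≤ G a * G b * ((1 - ‖a‖ ^ 2) * (1 - ‖b‖ ^ 2)) := by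
    intro a ha ha0 b hb
    have ha' : ‖a‖ < 1 := by simpa using ha
    have hb' : ‖b‖ < 1 := by simpa using hb
    rcases eq_or_ne b a with rfl | hne
    · rw [hGg b hb, ip_self]
      have : ‖(1 - ((‖b‖ ^ 2 : ℝ) : ℂ))‖ ^ 2 = (1 - ‖b‖ ^ 2) ^ 2 := by
        rw [← Complex.ofReal_one, ← Complex.ofReal_sub, Complex.norm_real, Real.norm_eq_abs, sq_abs]
      rw [this, Complex.norm_real, Real.norm_eq_abs, sq_abs]
      apply le_of_eq; ring
    · obtain ⟨φ, hφd, hφ1, hφa, hφb⟩ := extremal ha' hb' ha0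
      have hp := (pick 2 two_pos ![a, b] (by intro i; fin_cases i <;> simpa)
        (inj2 a b hne.symm) ![0, φ b]).2 ⟨φ, hφd, hφ1, by intro i; fin_cases i <;> simp [hφa]⟩
      have := psd_two_det _ (G a) ((1 - ‖φ b‖ ^ 2) * G b) (g a b) (by simp [hGg a ha])
        (by simp [hGg b hb, Complex.mul_conj']) (by simp) (by simp [herm b hb a ha]) hp
      rw [herm a ha b hb, RCLike.norm_conj] at this
      rw [← hφb]
      nlinarith [mul_le_mul_of_nonneg_right this (sq_nonneg ‖1 - ip b a‖)]
  -- two points, (B)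
  have hB : ∀ a ∈ ball (0 : EuclideanSpace ℂ (Fin 2)) 1,
      G 0 * G a * (1 - ‖a‖ ^ 2) ≤ ‖g a 0‖ ^ 2 := by
    intro a ha
    have ha' : ‖a‖ < 1 := by simpa using ha
    have hGa := hGpos a ha
    have hG0 := hGpos 0 h0m
    rcases eq_or_ne a 0 with rfl | hne
    · rw [hGg 0 h0m]
      simp
      apply le_of_eq; ring
    · by_contra hlt
      have hlt := not_le.1 hlt
      obtain ⟨u, hu⟩ : ∃ u : ℝ, u = 1 - ‖g a 0‖ ^ 2 / (G 0 * G a) := ⟨_, rfl⟩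
      have hu1 : ‖a‖ ^ 2 < u := by
        have : ‖g a 0‖ ^ 2 / (G 0 * G a) < 1 - ‖a‖ ^ 2 := by
          rw [div_lt_iff₀ (by positivity)]; linarith
        linarith
      have hu0 : 0 ≤ u := (sq_nonneg _).trans hu1.le
      have hs : √u ^ 2 = u := Real.sq_sqrt hu0
      have hp : (Matrix.of fun i j : Fin 2 =>
          (1 - ![0, (√u : ℂ)] i * (starRingEnd ℂ) (![0, (√u : ℂ)] j)) *
            g (![0, a] i) (![0, a] j)).PosSemidef := by
        refine psd_two _ (G 0) ((1 - u) * G a) (g 0 a) (by simp [hGg 0 h0m])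
          ?_ (by simp) (by simp [herm a ha 0 h0m]) hG0 ?_
        · simp [hGg a ha]
          left
          have hsc : ((√u ^ 2 : ℝ) : ℂ) = u := by rw [hs]
          push_cast at hsc
          rw [← hsc]; ring
        · rw [herm 0 h0m a ha, RCLike.norm_conj, hu]
          apply le_of_eq
          field_simp
          ring
      obtain ⟨φ, h1, h2, h3⟩ := (pick 2 two_pos ![0, a] (by intro i; fin_cases i <;> simpa)
        (inj2 0 a hne.symm) ![0, (√u : ℂ)]).1 hp
      have h4 : φ 0 = 0 := by simpa using h3 0
      have h5 : φ a = √u := by simpa using h3 1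
      have h6 := Complex.norm_le_norm_of_mapsTo_ball h1
        (fun w hw => by simpa using h2 w hw) h4 ha'
      rw [h5, Complex.norm_real, Real.norm_of_nonneg (Real.sqrt_nonneg _)] at h6
      nlinarith [Real.sqrt_nonneg u]
  have hG0 := hGpos 0 h0m
  have hf : ∀ a ∈ ball (0 : EuclideanSpace ℂ (Fin 2)) 1, g a 0 ≠ 0 := by
    intro a ha h
    have := hB a ha
    have ha' : ‖a‖ < 1 := by simpa using ha
    have h1 : 0 < 1 - ‖a‖ ^ 2 := by nlinarith [norm_nonneg a]
    have h2 := hGpos a ha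
    have : 0 < G 0 * G a * (1 - ‖a‖ ^ 2) := by positivity
    rw [h] at *
    simp at *
    linarith
  -- the kernel is a rescaled Drury-Arveson kernel
  have hker : ∀ a ∈ ball (0 : EuclideanSpace ℂ (Fin 2)) 1, a ≠ 0 →
      ∀ b ∈ ball (0 : EuclideanSpace ℂ (Fin 2)) 1,
      g b a = g b 0 * (starRingEnd ℂ) (g a 0) / (G 0 * (1 - ip b a)) := by
    intro a ha ha0 b hb
    have ha' : ‖a‖ < 1 := by simpa using ha
    have hG0c : (G 0 : ℂ) ≠ 0 := by exact_mod_cast hG0.ne'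
    have hmax := Complex.eqOn_of_isPreconnected_of_isMaxOn_norm
      (f := fun w => g w a * (1 - ip w a) / g w 0) (U := ball 0 1) (c := 0)
      (convex_ball _ _).isPreconnected isOpen_ball ?_ h0m ?_ hb
    · simp only [Function.const] at hmax
      have hip : ip 0 a = 0 := by simp [ip]
      rw [hip, hGg 0 h0m, herm 0 h0m a ha, div_eq_div_iff (hf b hb) hG0c] at hmax
      have := one_sub_ip_ne (show ‖b‖ < 1 by simpa using hb) ha'
      rw [eq_div_iff (mul_ne_zero hG0c this)]
      linear_combination hmax
    · have := ip_diff a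
      exact diff_div ((hol a ha).mul (by fun_prop)) (hol 0 h0m) hf
    · intro w hw
      have hw' : ‖w‖ < 1 := by simpa using hw
      have hip : ip 0 a = 0 := by simp [ip]
      simp only [Set.mem_ofPred_eq, Function.comp, hip]
      rw [norm_div, norm_div, norm_mul, norm_mul, herm 0 h0m a ha, RCLike.norm_conj, hGg 0 h0m,
        Complex.norm_real, Real.norm_of_nonneg hG0.le, sub_zero, norm_one, mul_one,
        div_le_div_iff₀ (norm_pos_iff.2 (hf w hw)) hG0]
      refine abs_le_of_sq_le_sq' ?_ (by positivity) |>.2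
      have h1 := hA a ha ha0 w hw
      have h2 := hB a ha
      have h3 := hB w hw
      have hGa := hGpos a ha
      have hGw := hGpos w hw
      have e1 : 0 ≤ 1 - ‖a‖ ^ 2 := by nlinarith [norm_nonneg a]
      have e2 : 0 ≤ 1 - ‖w‖ ^ 2 := by nlinarith [norm_nonneg w]
      calc (‖g w a‖ * ‖1 - ip w a‖ * G 0) ^ 2
          = (‖g w a‖ ^ 2 * ‖1 - ip w a‖ ^ 2) * G 0 ^ 2 := by ring
        _ ≤ (G a * G w * ((1 - ‖a‖ ^ 2) * (1 - ‖w‖ ^ 2))) * G 0 ^ 2 := by gcongr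
        _ = (G 0 * G a * (1 - ‖a‖ ^ 2)) * (G 0 * G w * (1 - ‖w‖ ^ 2)) := by ring
        _ ≤ ‖g a 0‖ ^ 2 * ‖g w 0‖ ^ 2 := by gcongr
        _ = _ := by ring
  -- the four point problem
  have hpt : ∀ i, pt i ∈ ball (0 : EuclideanSpace ℂ (Fin 2)) 1 := by
    intro i
    have : ‖pt i‖ ^ 2 < 1 := by
      rw [nsq]
      fin_cases i <;> simp [pt] <;> norm_num
    rw [mem_ball_zero_iff]
    nlinarith [norm_nonneg (pt i)]
  have hpt0 : ∀ i, pt i ≠ 0 := by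
    intro i h
    have := congrArg (fun w : EuclideanSpace ℂ (Fin 2) => w 0) h
    fin_cases i <;> simp [pt] at this
  have hinj := pt_inj
  have hp := (pick 4 (by norm_num) pt hpt hinj (fun i => ep i / 2)).2
    ⟨fun w => 2 * (w 0 * w 1), by fun_prop, by
      intro w hw
      have hw' : ‖w‖ < 1 := by simpa using hw
      have := nsq w
      rw [norm_mul, norm_mul]
      simp
      nlinarith [norm_nonneg w, sq_nonneg (‖w 0‖ - ‖w 1‖)], by
      intro i
      fin_cases i <;> simp [pt, ep] <;> norm_num⟩
  have hq := hp.dotProduct_mulVec_nonneg (fun i => ep i / (starRingEnd ℂ) (g (pt i) 0))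
  have hterm : ∀ i j, star (ep i / (starRingEnd ℂ) (g (pt i) 0)) *
      (((1 - ep i / 2 * (starRingEnd ℂ) (ep j / 2)) * g (pt i) (pt j)) *
        (ep j / (starRingEnd ℂ) (g (pt j) 0))) =
      ep i * ep j * (1 - ep i * ep j / 4) / (1 - ip (pt i) (pt j)) / G 0 := by
    intro i j
    have hc : ∀ i, (starRingEnd ℂ) (ep i) = ep i := by
      intro i; fin_cases i <;> simp [ep]
    have h1 := hf _ (hpt i)
    have h2 : (starRingEnd ℂ) (g (pt j) 0) ≠ 0 := by simpa using hf _ (hpt j)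
    have h3 := one_sub_ip_ne (show ‖pt i‖ < 1 by simpa using hpt i)
      (show ‖pt j‖ < 1 by simpa using hpt j)
    have hG0c : (G 0 : ℂ) ≠ 0 := by exact_mod_cast hG0.ne'
    rw [hker _ (hpt j) (hpt0 j) _ (hpt i)]
    simp only [RCLike.star_def, map_div₀, Complex.conj_conj, hc, map_ofNat]
    field_simp
    ring
  have hsum : star (fun i => ep i / (starRingEnd ℂ) (g (pt i) 0)) ⬝ᵥ
      ((Matrix.of fun i j : Fin 4 =>
        (1 - ep i / 2 * (starRingEnd ℂ) (ep j / 2)) * g (pt i) (pt j)).mulVec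
        (fun i => ep i / (starRingEnd ℂ) (g (pt i) 0))) = ((-2 / G 0 : ℝ) : ℂ) := by
    simp only [dotProduct, Matrix.mulVec, Matrix.of_apply, Pi.star_apply, Finset.mul_sum, hterm]
    simp only [Fin.sum_univ_four]
    simp [ep, pt, ip, conj_two]
    norm_num
    ring
  rw [hsum] at hq
  have hq' : 0 ≤ -2 / G 0 := by exact_mod_cast hq
  have : -2 / G 0 < 0 := div_neg_of_neg_of_pos (by norm_num) hG0
  linarith
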